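/- Consider the quaternionic linear system (1.1): Φ' = A(t)Φ + B(t)Ψ, Ψ' = C(t)Φ + D(t)Ψ on [t₀,∞), and the scalar comparison system (2.6): φ' = 𝔞*(t)φ + ‖B(t)‖ψ, ψ' = ‖C(t)‖φ + 𝔡*(t)ψ on [t₀,∞). Assume hypotheses (a) and (b) hold. If every solution (φ, ψ) of the scalar system (2.6) tends to 0 as t → +∞, then every solution (Φ, Ψ) of the system (1.1) tends to 0 as t → +∞. -/

import Mathlib

open scoped Quaternion
open Set Filter Matrix

/-- The Euclidean norm `‖q‖ = √(|q₁|² + ⋯ + |qₙ|²)` on `ℍⁿ`. -/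
noncomputable def euclNorm {n : ℕ} (q : Fin n → ℍ[ℝ]) : ℝ :=
  Real.sqrt (∑ i, ‖q i‖ ^ 2)

/-- The operator norm `‖M‖ = sup_{q ≠ 0} ‖M q‖ / ‖q‖` of a quaternionic matrix,
with respect to the Euclidean norms. -/
noncomputable def qOpNorm {m n : ℕ} (M : Matrix (Fin m) (Fin n) ℍ[ℝ]) : ℝ :=
  sSup {r : ℝ | ∃ q : Fin n → ℍ[ℝ], q ≠ 0 ∧ r = euclNorm (M.mulVec q) / euclNorm q}

/-- The entrywise integral `∫_τ^t A(s) ds` of a quaternionic matrix function. -/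
noncomputable def matInt {k : ℕ} (A : ℝ → Matrix (Fin k) (Fin k) ℍ[ℝ]) (τ t : ℝ) :
    Matrix (Fin k) (Fin k) ℍ[ℝ] :=
  Matrix.of fun i j => ∫ s in τ..t, A s i j

open scoped BoundedContinuousFunction in
theorem exists_hasDerivAt_clm_apply {E : Type*} [NormedAddCommGroup E] [NormedSpace ℝ E]
    [CompleteSpace E] {M : ℝ → E →L[ℝ] E} (hM : Continuous M) (t₀ : ℝ) (y₀ : E) :
    ∃ y : ℝ → E, y t₀ = y₀ ∧ ∀ t, t₀ ≤ t → HasDerivAt y (M t (y t)) t := by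
  -- Picard iteration is a contraction for the norm weighted by `exp (-2 * ∫ ‖M‖)`.
  set κ : ℝ → ℝ := fun t => ∫ s in t₀..t, ‖M s‖ with hκ
  set w : ℝ → ℝ := fun t => Real.exp (2 * κ t) with hw
  have hκd : ∀ t, HasDerivAt κ ‖M t‖ t := fun t =>
    (hM.norm.integral_hasStrictDerivAt t₀ t).hasDerivAt
  have hwd : ∀ t, HasDerivAt w (2 * (w t * ‖M t‖)) t := fun t => by
    have := ((hκd t).const_mul 2).exp
    convert this using 1
    simp only [hw]; ring
  have hwc : Continuous w := continuous_iff_continuousAt.2 fun t => (hwd t).continuousAt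
  have hwpos : ∀ t, 0 < w t := fun t => Real.exp_pos _
  have hw0 : w t₀ = 1 := by simp [hw, hκ]
  have hw1 : ∀ t, t₀ ≤ t → 1 ≤ w t := fun t ht => by
    apply Real.one_le_exp
    have : 0 ≤ κ t := intervalIntegral.integral_nonneg ht fun s _ => norm_nonneg _
    positivity
  have hint : ∀ t, ∫ s in t₀..t, w s * ‖M s‖ = (w t - 1) / 2 := fun t => by
    have := intervalIntegral.integral_eq_sub_of_hasDerivAt (a := t₀) (b := t) (fun s _ => hwd s)
      ((continuous_const.mul (hwc.mul hM.norm)).intervalIntegrable _ _)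
    rw [intervalIntegral.integral_const_mul, hw0] at this
    linarith
  have hgc : ∀ z : ℝ →ᵇ E, Continuous fun s => w s • M s (z s) := fun z =>
    hwc.smul (hM.clm_apply z.continuous)
  have hIbound : ∀ (z : ℝ →ᵇ E) (t : ℝ), t₀ ≤ t →
      ‖∫ s in t₀..t, w s • M s (z s)‖ ≤ w t * (‖z‖ / 2) := fun z t ht => by
    have h1 : ‖∫ s in t₀..t, w s • M s (z s)‖ ≤ ∫ s in t₀..t, w s * ‖M s‖ * ‖z‖ := by
      apply intervalIntegral.norm_integral_le_of_norm_le ht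
      · refine MeasureTheory.ae_of_all _ fun s _ => ?_
        rw [norm_smul, Real.norm_of_nonneg (hwpos s).le, mul_assoc]
        gcongr
        exact (M s).le_opNorm_of_le (z.norm_coe_le_norm s)
      · exact ((hwc.mul hM.norm).mul continuous_const).intervalIntegrable _ _
    rw [intervalIntegral.integral_mul_const, hint] at h1
    nlinarith [norm_nonneg z]
  set T : (ℝ →ᵇ E) → (ℝ →ᵇ E) := fun z =>
    BoundedContinuousFunction.ofNormedAddCommGroup
      (fun t => (w (max t t₀))⁻¹ • (y₀ + ∫ s in t₀..max t t₀, w s • M s (z s)))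
      (by
        have hm : Continuous fun t => max t t₀ := by fun_prop
        refine ((hwc.comp hm).inv₀ fun t => (hwpos _).ne').smul (continuous_const.add ?_)
        exact (intervalIntegral.continuous_primitive
          (fun a b => (hgc z).intervalIntegrable a b) t₀).comp hm)
      (‖y₀‖ + ‖z‖ / 2)
      (fun t => by
        have h := hIbound z _ (le_max_right t t₀)
        have h1 := hw1 _ (le_max_right t t₀)
        rw [norm_smul, norm_inv, Real.norm_of_nonneg (hwpos _).le, inv_mul_le_iff₀ (hwpos _)]
        refine (norm_add_le _ _).trans ?_
        nlinarith [norm_nonneg y₀])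
  have hTapp : ∀ z t, T z t = (w (max t t₀))⁻¹ • (y₀ + ∫ s in t₀..max t t₀, w s • M s (z s)) :=
    fun _ _ => rfl
  have hcontr : ContractingWith (1 / 2) T := by
    refine ⟨by norm_num, LipschitzWith.of_dist_le_mul fun z z' => ?_⟩
    rw [BoundedContinuousFunction.dist_le (by positivity)]
    intro t
    have h := hIbound (z - z') _ (le_max_right t t₀)
    have hsub : T z t - T z' t =
        (w (max t t₀))⁻¹ • ∫ s in t₀..max t t₀, w s • M s ((z - z') s) := by
      rw [hTapp, hTapp, ← smul_sub, add_sub_add_left_eq_sub,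
        ← intervalIntegral.integral_sub ((hgc z).intervalIntegrable _ _)
          ((hgc z').intervalIntegrable _ _)]
      simp [smul_sub]
    rw [dist_eq_norm, hsub, norm_smul, norm_inv, Real.norm_of_nonneg (hwpos _).le,
      inv_mul_le_iff₀ (hwpos _), dist_eq_norm]
    refine h.trans (le_of_eq ?_)
    push_cast
    ring
  set z := hcontr.fixedPoint
  have hz : T z = z := hcontr.fixedPoint_isFixedPt
  refine ⟨fun t => y₀ + ∫ s in t₀..t, w s • M s (z s), by simp, fun t ht => ?_⟩
  have hzt : w t • z t = y₀ + ∫ s in t₀..t, w s • M s (z s) := by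
    conv_lhs => rw [← hz]
    rw [hTapp, max_eq_left ht, smul_inv_smul₀ (hwpos t).ne']
  have := ((hgc z).integral_hasStrictDerivAt t₀ t).hasDerivAt.const_add y₀
  rwa [← map_smul, hzt] at this

theorem exists_planar_linear_solution {t₀ : ℝ} {a b c d : ℝ → ℝ}
    (ha : ContinuousOn a (Ici t₀)) (hb : ContinuousOn b (Ici t₀))
    (hc : ContinuousOn c (Ici t₀)) (hd : ContinuousOn d (Ici t₀)) (x₀ y₀ : ℝ) :
    ∃ φ ψ : ℝ → ℝ, φ t₀ = x₀ ∧ ψ t₀ = y₀ ∧ ∀ t ∈ Ici t₀,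
      HasDerivAt φ (a t * φ t + b t * ψ t) t ∧ HasDerivAt ψ (c t * φ t + d t * ψ t) t := by
  have hext : ∀ {f : ℝ → ℝ}, ContinuousOn f (Ici t₀) → Continuous fun t => f (max t t₀) :=
    fun hf => hf.comp_continuous (by fun_prop) fun t => le_max_right t t₀
  have ha' := hext ha
  have hb' := hext hb
  have hc' := hext hc
  have hd' := hext hd
  let fst := ContinuousLinearMap.fst ℝ ℝ ℝ
  let snd := ContinuousLinearMap.snd ℝ ℝ ℝ
  let inl := ContinuousLinearMap.inl ℝ ℝ ℝ
  let inr := ContinuousLinearMap.inr ℝ ℝ ℝ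
  let M : ℝ → ℝ × ℝ →L[ℝ] ℝ × ℝ := fun t =>
    a (max t t₀) • inl.comp fst + b (max t t₀) • inl.comp snd
      + c (max t t₀) • inr.comp fst + d (max t t₀) • inr.comp snd
  have hM : Continuous M := 
    (((ha'.smul continuous_const).add (hb'.smul continuous_const)).add
      (hc'.smul continuous_const)).add (hd'.smul continuous_const)
  obtain ⟨y, hy0, hy⟩ := exists_hasDerivAt_clm_apply hM t₀ (x₀, y₀)
  refine ⟨fun t => (y t).1, fun t => (y t).2, by simp [hy0], by simp [hy0], fun t ht => ?_⟩
  have h := hy t ht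
  constructor
  · refine (fst.hasFDerivAt.comp_hasDerivAt t h).congr_deriv ?_
    simp [M, fst, snd, inl, inr, max_eq_left (mem_Ici.1 ht)]
  · refine (snd.hasFDerivAt.comp_hasDerivAt t h).congr_deriv ?_
    simp [M, fst, snd, inl, inr, max_eq_left (mem_Ici.1 ht)]

theorem lt_of_sq_deriv_le {t₀ T : ℝ} (hT : t₀ ≤ T) {a b φ ψ p q P' : ℝ → ℝ}
    (ha : ContinuousOn a (Ici t₀)) (hb : ∀ t ∈ Ici t₀, 0 ≤ b t)
    (hφ : ∀ t ∈ Ici t₀, HasDerivAt φ (a t * φ t + b t * ψ t) t)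
    (hp : ∀ t, 0 ≤ p t) (hq : ∀ t, 0 ≤ q t)
    (hP : ∀ t ∈ Ici t₀, HasDerivAt (fun t => p t ^ 2) (P' t) t)
    (hP' : ∀ t ∈ Ici t₀, P' t ≤ 2 * (a t * p t ^ 2 + b t * (p t * q t)))
    (h₀ : p t₀ < φ t₀) (hpφ : ∀ t ∈ Icc t₀ T, p t ≤ φ t) (hqψ : ∀ t ∈ Icc t₀ T, q t ≤ ψ t) :
    p T < φ T := by
  have hac : Continuous fun t => a (max t t₀) :=
    ha.comp_continuous (by fun_prop) fun t => le_max_right t t₀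
  set α : ℝ → ℝ := fun t => ∫ s in t₀..t, a (max s t₀)
  have hαd : ∀ t ∈ Ici t₀, HasDerivAt α (a t) t := fun t ht => by
    simpa [max_eq_left (mem_Ici.1 ht)] using (hac.integral_hasStrictDerivAt t₀ t).hasDerivAt
  set W : ℝ → ℝ := fun t => Real.exp (-2 * α t) * (φ t ^ 2 - p t ^ 2)
  have hWd : ∀ t ∈ Ici t₀, HasDerivAt W
      (Real.exp (-2 * α t) * (2 * (b t * (φ t * ψ t)) + (2 * (a t * p t ^ 2) - P' t))) t :=
    fun t ht => by
      have := (((hαd t ht).const_mul (-2)).exp).mul (((hφ t ht).pow 2).sub (hP t ht))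
      refine this.congr_deriv ?_
      simp only [Nat.cast_ofNat, Pi.pow_apply, Pi.sub_apply]
      ring
  have hmono : MonotoneOn W (Icc t₀ T) := by
    refine monotoneOn_of_hasDerivWithinAt_nonneg (convex_Icc _ _)
      (fun t ht => (hWd t ht.1).continuousAt.continuousWithinAt)
      (fun t ht => (hWd t (interior_subset ht).1).hasDerivWithinAt) fun t ht => ?_
    have ht' := interior_subset ht
    have h1 := hP' t ht'.1
    have h2 : b t * (p t * q t) ≤ b t * (φ t * ψ t) :=
      mul_le_mul_of_nonneg_left (mul_le_mul (hpφ t ht') (hqψ t ht') (hq t)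
        ((hp t).trans (hpφ t ht'))) (hb t ht'.1)
    exact mul_nonneg (Real.exp_pos _).le (by linarith)
  have h0 : 0 < W t₀ := mul_pos (Real.exp_pos _) (by nlinarith [hp t₀])
  have h1 : 0 < W T := h0.trans_le (hmono (left_mem_Icc.2 hT) (right_mem_Icc.2 hT) hT)
  have h2 : 0 < φ T ^ 2 - p T ^ 2 := pos_of_mul_pos_right h1 (Real.exp_pos _).le
  exact lt_of_pow_lt_pow_left₀ 2 ((hp T).trans (hpφ T (right_mem_Icc.2 hT))) (by linarith)

theorem lt_of_cooperative_comparison {t₀ : ℝ} {a b c d φ ψ p q P' Q' : ℝ → ℝ}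
    (ha : ContinuousOn a (Ici t₀)) (hd : ContinuousOn d (Ici t₀))
    (hb : ∀ t ∈ Ici t₀, 0 ≤ b t) (hc : ∀ t ∈ Ici t₀, 0 ≤ c t)
    (hφ : ∀ t ∈ Ici t₀, HasDerivAt φ (a t * φ t + b t * ψ t) t)
    (hψ : ∀ t ∈ Ici t₀, HasDerivAt ψ (c t * φ t + d t * ψ t) t)
    (hp : ∀ t, 0 ≤ p t) (hq : ∀ t, 0 ≤ q t)
    (hP : ∀ t ∈ Ici t₀, HasDerivAt (fun t => p t ^ 2) (P' t) t)
    (hQ : ∀ t ∈ Ici t₀, HasDerivAt (fun t => q t ^ 2) (Q' t) t)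
    (hP' : ∀ t ∈ Ici t₀, P' t ≤ 2 * (a t * p t ^ 2 + b t * (p t * q t)))
    (hQ' : ∀ t ∈ Ici t₀, Q' t ≤ 2 * (d t * q t ^ 2 + c t * (q t * p t)))
    (hp₀ : p t₀ < φ t₀) (hq₀ : q t₀ < ψ t₀) :
    ∀ t ∈ Ici t₀, p t < φ t ∧ q t < ψ t := by
  have cont_of_sq : ∀ {f F' : ℝ → ℝ}, (∀ t, 0 ≤ f t) →
      (∀ t ∈ Ici t₀, HasDerivAt (fun t => f t ^ 2) (F' t) t) → ContinuousOn f (Ici t₀) := by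
    intro f F' hf hF t ht
    have := (hF t ht).continuousAt.sqrt
    simp only [Real.sqrt_sq (hf _)] at this
    exact this.continuousWithinAt
  have hpc := cont_of_sq hp hP
  have hqc := cont_of_sq hq hQ
  have hφc : ContinuousOn φ (Ici t₀) := fun t ht => (hφ t ht).continuousAt.continuousWithinAt
  have hψc : ContinuousOn ψ (Ici t₀) := fun t ht => (hψ t ht).continuousAt.continuousWithinAt
  by_contra! hcon
  obtain ⟨t', ht', hbad⟩ := hcon
  -- `sInf S` is the first time at which one of the strict inequalities fails.
  set S : Set ℝ := {t | t ∈ Ici t₀ ∧ φ t ≤ p t} ∪ {t | t ∈ Ici t₀ ∧ ψ t ≤ q t}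
  have hSclosed : IsClosed S :=
    (isClosed_Ici.isClosed_le hφc hpc).union (isClosed_Ici.isClosed_le hψc hqc)
  have hSne : S.Nonempty := by
    refine ⟨t', ?_⟩
    rcases lt_or_ge (p t') (φ t') with h | h
    · exact Or.inr ⟨ht', hbad h⟩
    · exact Or.inl ⟨ht', h⟩
  have hSge : ∀ t ∈ S, t₀ ≤ t := fun t ht => ht.elim And.left And.left
  have hSbdd : BddBelow S := ⟨t₀, hSge⟩
  have hmem : sInf S ∈ S := hSclosed.csInf_mem hSne hSbdd
  set T := sInf S
  have hT : t₀ ≤ T := hSge T hmem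
  have hne : t₀ ≠ T := by
    intro h
    rw [← h] at hmem
    rcases hmem with h | h
    · exact h.2.not_gt hp₀
    · exact h.2.not_gt hq₀
  have hlt : ∀ t ∈ Ico t₀ T, p t ≤ φ t ∧ q t ≤ ψ t := fun t ht => by
    have hnot : t ∉ S := fun h => (csInf_le hSbdd h).not_gt ht.2
    constructor
    · by_contra! h
      exact hnot (Or.inl ⟨ht.1, h.le⟩)
    · by_contra! h
      exact hnot (Or.inr ⟨ht.1, h.le⟩)
  have hcl : closure (Ico t₀ T) = Icc t₀ T := closure_Ico hne
  have hsub : Icc t₀ T ⊆ Ici t₀ := Icc_subset_Ici_self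
  have hpφ : ∀ t ∈ Icc t₀ T, p t ≤ φ t := fun t ht =>
    le_on_closure (fun s hs => (hlt s hs).1) (hcl ▸ hpc.mono hsub) (hcl ▸ hφc.mono hsub)
      (hcl ▸ ht)
  have hqψ : ∀ t ∈ Icc t₀ T, q t ≤ ψ t := fun t ht =>
    le_on_closure (fun s hs => (hlt s hs).2) (hcl ▸ hqc.mono hsub) (hcl ▸ hψc.mono hsub)
      (hcl ▸ ht)
  rcases hmem with h | h
  · exact h.2.not_gt (lt_of_sq_deriv_le hT ha hb hφ hp hq hP hP' hp₀ hpφ hqψ)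
  · exact h.2.not_gt (lt_of_sq_deriv_le hT hd hc
      (fun t ht => (hψ t ht).congr_deriv (add_comm _ _)) hq hp hQ hQ' hq₀ hqψ hpφ)

theorem euclNorm_eq_norm {n : ℕ} (q : Fin n → ℍ[ℝ]) : euclNorm q = ‖WithLp.toLp 2 q‖ := by
  rw [PiLp.norm_eq_of_L2]; rfl

theorem euclNorm_nonneg {n : ℕ} (q : Fin n → ℍ[ℝ]) : 0 ≤ euclNorm q := Real.sqrt_nonneg _

theorem euclNorm_sq {n : ℕ} (q : Fin n → ℍ[ℝ]) : euclNorm q ^ 2 = ∑ i, ‖q i‖ ^ 2 :=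
  Real.sq_sqrt (by positivity)

/-- The real-linear operator between Euclidean spaces given by a quaternionic matrix, as a
real-linear function of the matrix. -/
noncomputable def mulVecCLM (m n : ℕ) : Matrix (Fin m) (Fin n) ℍ[ℝ] →ₗ[ℝ]
    (PiLp 2 (fun _ : Fin n => ℍ[ℝ]) →L[ℝ] PiLp 2 (fun _ : Fin m => ℍ[ℝ])) where
  toFun M := LinearMap.toContinuousLinearMap
    { toFun := fun q => WithLp.toLp 2 (M *ᵥ q.ofLp)
      map_add' := fun x y => by ext1; simp [mulVec_add]
      map_smul' := fun r x => by ext1; simp [mulVec_smul] }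
  map_add' M N := by ext1; simp [add_mulVec]
  map_smul' r M := by ext1; simp [smul_mulVec]

theorem mulVecCLM_apply {m n : ℕ} (M : Matrix (Fin m) (Fin n) ℍ[ℝ]) (q : Fin n → ℍ[ℝ]) :
    mulVecCLM m n M (WithLp.toLp 2 q) = WithLp.toLp 2 (M *ᵥ q) := rfl

theorem qOpNorm_eq_norm {m n : ℕ} (M : Matrix (Fin m) (Fin n) ℍ[ℝ]) :
    qOpNorm M = ‖mulVecCLM m n M‖ := by
  have hle : ∀ q : Fin n → ℍ[ℝ], euclNorm (M *ᵥ q) / euclNorm q ≤ ‖mulVecCLM m n M‖ := fun q => by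
    rw [euclNorm_eq_norm, euclNorm_eq_norm, ← mulVecCLM_apply]
    exact (mulVecCLM m n M).ratio_le_opNorm _
  have hbdd : BddAbove {r : ℝ | ∃ q : Fin n → ℍ[ℝ], q ≠ 0 ∧
      r = euclNorm (M.mulVec q) / euclNorm q} := by
    refine ⟨‖mulVecCLM m n M‖, ?_⟩
    rintro r ⟨q, -, rfl⟩
    exact hle q
  refine le_antisymm (Real.sSup_le ?_ (norm_nonneg (mulVecCLM m n M))) ?_
  · rintro r ⟨q, -, rfl⟩
    exact hle q
  · refine ContinuousLinearMap.opNorm_le_bound' _ (Real.sSup_nonneg ?_) fun x hx => ?_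
    · rintro r ⟨q, -, rfl⟩
      exact div_nonneg (euclNorm_nonneg _) (euclNorm_nonneg _)
    · obtain ⟨q, rfl⟩ : ∃ q, x = WithLp.toLp 2 q := ⟨x.ofLp, rfl⟩
      rw [mulVecCLM_apply, ← div_le_iff₀ (lt_of_le_of_ne (norm_nonneg _) hx.symm)]
      refine le_csSup hbdd ⟨q, ?_, by rw [euclNorm_eq_norm, euclNorm_eq_norm]⟩
      rintro rfl
      simp at hx

theorem qOpNorm_nonneg {m n : ℕ} (M : Matrix (Fin m) (Fin n) ℍ[ℝ]) : 0 ≤ qOpNorm M :=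
  qOpNorm_eq_norm M ▸ norm_nonneg (mulVecCLM m n M)

theorem euclNorm_mulVec_le {m n : ℕ} (M : Matrix (Fin m) (Fin n) ℍ[ℝ]) (q : Fin n → ℍ[ℝ]) :
    euclNorm (M *ᵥ q) ≤ qOpNorm M * euclNorm q := by
  rw [qOpNorm_eq_norm, euclNorm_eq_norm, euclNorm_eq_norm, ← mulVecCLM_apply]
  exact ContinuousLinearMap.le_opNorm _ _

theorem continuousOn_qOpNorm {m n : ℕ} {B : ℝ → Matrix (Fin m) (Fin n) ℍ[ℝ]} {s : Set ℝ}
    (hB : ∀ i j, ContinuousOn (fun t => B t i j) s) : ContinuousOn (fun t => qOpNorm (B t)) s := by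
  simp only [qOpNorm_eq_norm]
  have h : Continuous (mulVecCLM m n) := LinearMap.continuous_of_finiteDimensional _
  have hcomp : ContinuousOn (fun t => mulVecCLM m n (B t)) s :=
    h.comp_continuousOn (continuousOn_pi.2 fun i => continuousOn_pi.2 fun j => hB i j)
  exact (continuous_norm (E := PiLp 2 (fun _ : Fin n => ℍ[ℝ]) →L[ℝ]
    PiLp 2 (fun _ : Fin m => ℍ[ℝ]))).comp_continuousOn hcomp

theorem sum_inner_mulVec_le {m n : ℕ} (M : Matrix (Fin m) (Fin n) ℍ[ℝ]) (x : Fin m → ℍ[ℝ])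
    (q : Fin n → ℍ[ℝ]) :
    ∑ i, inner ℝ (x i) ((M *ᵥ q) i) ≤ qOpNorm M * (euclNorm x * euclNorm q) := by
  have h := real_inner_le_norm (WithLp.toLp 2 x) (WithLp.toLp 2 (M *ᵥ q))
  rw [PiLp.inner_apply, ← euclNorm_eq_norm, ← euclNorm_eq_norm] at h
  refine h.trans ?_
  calc _ ≤ euclNorm x * (qOpNorm M * euclNorm q) :=
        mul_le_mul_of_nonneg_left (euclNorm_mulVec_le M q) (euclNorm_nonneg x)
    _ = _ := by ring

theorem inner_mul_self_eq (a w : ℍ[ℝ]) : inner ℝ w (a * w) = a.re * ‖w‖ ^ 2 := by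
  rw [Quaternion.inner_def, pow_two, ← Quaternion.normSq_eq_norm_mul_self, Quaternion.normSq_def']
  simp
  ring

theorem sum_inner_eq_re_dotProduct {n : ℕ} (x y : Fin n → ℍ[ℝ]) :
    ∑ i, inner ℝ (x i) (y i) = (star x ⬝ᵥ y).re := by
  let re : ℍ[ℝ] →+ ℝ := AddMonoidHom.mk' QuaternionAlgebra.re fun _ _ => rfl
  change _ = re (∑ i, star x i * y i)
  rw [map_sum]
  refine Finset.sum_congr rfl fun i _ => ?_
  change _ = (star (x i) * y i).re
  rw [Quaternion.inner_def]
  simp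

theorem sum_norm_sq_eq_re_dotProduct {n : ℕ} (x : Fin n → ℍ[ℝ]) :
    ∑ i, ‖x i‖ ^ 2 = (star x ⬝ᵥ x).re := by
  rw [← sum_inner_eq_re_dotProduct]
  simp

/-- The numerical range of a unitarily diagonalizable matrix is bounded by the real parts of the
diagonal entries. -/
theorem sum_inner_unitary_conj_diagonal_le {k : ℕ} {U : Matrix (Fin k) (Fin k) ℍ[ℝ]}
    {a : Fin k → ℍ[ℝ]} {c : ℝ} (hU : U * Uᴴ = 1) (ha : ∀ l, (a l).re ≤ c) (v : Fin k → ℍ[ℝ]) :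
    ∑ i, inner ℝ (v i) (((U * diagonal a * Uᴴ) *ᵥ v) i) ≤ c * ∑ i, ‖v i‖ ^ 2 := by
  have hw : star (Uᴴ *ᵥ v) = star v ᵥ* U := by rw [star_mulVec, conjTranspose_conjTranspose]
  have hnorm : ∑ i, ‖v i‖ ^ 2 = ∑ l, ‖(Uᴴ *ᵥ v) l‖ ^ 2 := by
    rw [sum_norm_sq_eq_re_dotProduct, sum_norm_sq_eq_re_dotProduct, hw, ← dotProduct_mulVec,
      mulVec_mulVec, hU, one_mulVec]
  have hform : star v ⬝ᵥ ((U * diagonal a * Uᴴ) *ᵥ v)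
      = star (Uᴴ *ᵥ v) ⬝ᵥ (diagonal a *ᵥ (Uᴴ *ᵥ v)) := by
    rw [hw, ← dotProduct_mulVec, mulVec_mulVec, mulVec_mulVec, Matrix.mul_assoc]
  rw [sum_inner_eq_re_dotProduct, hform, ← sum_inner_eq_re_dotProduct, hnorm, Finset.mul_sum]
  refine Finset.sum_le_sum fun l _ => ?_
  rw [mulVec_diagonal, inner_mul_self_eq]
  exact mul_le_mul_of_nonneg_right (ha l) (by positivity)

/-- An infinitesimal version of a bound on the numerical range of the integrals of `A`. -/
theorem sum_inner_mulVec_le_of_matInt {k : ℕ} {t₀ : ℝ} {A : ℝ → Matrix (Fin k) (Fin k) ℍ[ℝ]}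
    {α : ℝ → ℝ} (hA : ∀ i j, ContinuousOn (fun t => A t i j) (Ici t₀))
    (hα : ContinuousOn α (Ici t₀))
    (h : ∀ τ t, t₀ ≤ τ → τ ≤ t →
      ∃ (U : Matrix (Fin k) (Fin k) ℍ[ℝ]) (a : Fin k → ℍ[ℝ]),
        U * Uᴴ = 1 ∧ Uᴴ * U = 1 ∧ matInt A τ t = U * Matrix.diagonal a * Uᴴ ∧
        ∀ l, (a l).re ≤ ∫ s in τ..t, α s) {τ : ℝ} (hτ : τ ∈ Ici t₀) (v : Fin k → ℍ[ℝ]) :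
    ∑ i, inner ℝ (v i) ((A τ *ᵥ v) i) ≤ α τ * ∑ i, ‖v i‖ ^ 2 := by
  have hint : ∀ {E : Type} [NormedAddCommGroup E] [NormedSpace ℝ E] [CompleteSpace E] {f : ℝ → E},
      ContinuousOn f (Ici t₀) → HasDerivWithinAt (fun t => ∫ s in τ..t, f s) (f τ) (Ici τ) τ := by
    intro E _ _ _ f hf
    have hf' : ContinuousOn f (Ici τ) := hf.mono (Ici_subset_Ici.2 hτ)
    refine intervalIntegral.integral_hasDerivWithinAt_right (by simp) (t := Ioi τ) ?_ ?_
    · exact (hf'.mono Ioi_subset_Ici_self).stronglyMeasurableAtFilter_nhdsWithin measurableSet_Ioi _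
    · exact (hf' τ self_mem_Ici).mono Ioi_subset_Ici_self
  have hF : HasDerivWithinAt (fun t => ∑ i, inner ℝ (v i) ((matInt A τ t *ᵥ v) i))
      (∑ i, inner ℝ (v i) ((A τ *ᵥ v) i)) (Ici τ) τ := by
    refine HasDerivWithinAt.fun_sum fun i _ => ?_
    have h1 : HasDerivWithinAt (fun t => (matInt A τ t *ᵥ v) i) ((A τ *ᵥ v) i) (Ici τ) τ :=
      HasDerivWithinAt.fun_sum (u := Finset.univ) fun j _ => (hint (hA i j)).mul_const (v j)
    simpa using (hasDerivWithinAt_const τ (Ici τ) (v i)).inner ℝ h1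
  have hG := ((hint hα).mul_const (∑ i, ‖v i‖ ^ 2)).sub hF
  rw [← sub_nonneg]
  rw [hasDerivWithinAt_iff_tendsto_slope, Ici_sdiff_left] at hG
  refine ge_of_tendsto hG ?_
  filter_upwards [self_mem_nhdsWithin] with t ht
  obtain ⟨U, a, hU, -, hUa, hal⟩ := h τ t hτ (le_of_lt ht)
  have hb := sum_inner_unitary_conj_diagonal_le hU hal v
  rw [← hUa] at hb
  have h0 : matInt A τ τ = 0 := by ext1 i j; simp [matInt]
  rw [slope_def_field]
  refine div_nonneg ?_ (sub_nonneg.2 (le_of_lt ht))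
  simpa [h0] using hb

theorem hasDerivAt_euclNorm_sq {n : ℕ} {Φ : ℝ → Fin n → ℍ[ℝ]} {Φ' : Fin n → ℍ[ℝ]} {t : ℝ}
    (h : HasDerivAt Φ Φ' t) :
    HasDerivAt (fun t => euclNorm (Φ t) ^ 2) (2 * ∑ i, inner ℝ (Φ t i) (Φ' i)) t := by
  simp only [euclNorm_sq, Finset.mul_sum]
  exact HasDerivAt.fun_sum fun i _ => (hasDerivAt_pi.1 h i).norm_sq

/-- **Lemma 2.4, asymptotic part**. Under hypotheses (a) and (b), asymptotic
stability of the scalar comparison system (2.6) implies asymptotic stability of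
the quaternionic linear system (1.1). -/
theorem asymptotically_stable_of_scalar_comparison {m n : ℕ} (t₀ : ℝ)
    (A : ℝ → Matrix (Fin m) (Fin m) ℍ[ℝ]) (B : ℝ → Matrix (Fin m) (Fin n) ℍ[ℝ])
    (C : ℝ → Matrix (Fin n) (Fin m) ℍ[ℝ]) (D : ℝ → Matrix (Fin n) (Fin n) ℍ[ℝ])
    (𝔞 𝔡 : ℝ → ℝ)
    (hA : ∀ i j, ContinuousOn (fun t => A t i j) (Ici t₀))
    (hB : ∀ i j, ContinuousOn (fun t => B t i j) (Ici t₀))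
    (hC : ∀ i j, ContinuousOn (fun t => C t i j) (Ici t₀))
    (hD : ∀ i j, ContinuousOn (fun t => D t i j) (Ici t₀))
    (h𝔞 : ContinuousOn 𝔞 (Ici t₀)) (h𝔡 : ContinuousOn 𝔡 (Ici t₀))
    -- hypothesis (a)
    (haA : ∀ t ∈ Ici t₀, ∀ τ ∈ Ici t₀, A t * matInt A t₀ τ = matInt A t₀ τ * A t)
    (haD : ∀ t ∈ Ici t₀, ∀ τ ∈ Ici t₀, D t * matInt D t₀ τ = matInt D t₀ τ * D t)
    -- hypothesis (b)
    (hbA : ∀ τ t, t₀ ≤ τ → τ ≤ t →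
      ∃ (U : Matrix (Fin m) (Fin m) ℍ[ℝ]) (a : Fin m → ℍ[ℝ]),
        U * Uᴴ = 1 ∧ Uᴴ * U = 1 ∧ matInt A τ t = U * Matrix.diagonal a * Uᴴ ∧
        ∀ l, (a l).re ≤ ∫ s in τ..t, 𝔞 s)
    (hbD : ∀ τ t, t₀ ≤ τ → τ ≤ t →
      ∃ (V : Matrix (Fin n) (Fin n) ℍ[ℝ]) (d : Fin n → ℍ[ℝ]),
        V * Vᴴ = 1 ∧ Vᴴ * V = 1 ∧ matInt D τ t = V * Matrix.diagonal d * Vᴴ ∧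
        ∀ r, (d r).re ≤ ∫ s in τ..t, 𝔡 s)
    -- every solution of the scalar comparison system (2.6) tends to 0 at +∞
    (hscalar : ∀ φ ψ : ℝ → ℝ,
      (∀ t ∈ Ici t₀,
        HasDerivAt φ (𝔞 t * φ t + qOpNorm (B t) * ψ t) t ∧
        HasDerivAt ψ (qOpNorm (C t) * φ t + 𝔡 t * ψ t) t) →
      Tendsto φ atTop (nhds 0) ∧ Tendsto ψ atTop (nhds 0)) :
    -- then every solution of the system (1.1) tends to 0 at +∞
    ∀ (Φ : ℝ → Fin m → ℍ[ℝ]) (Ψ : ℝ → Fin n → ℍ[ℝ]),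
      (∀ t ∈ Ici t₀,
        HasDerivAt Φ ((A t).mulVec (Φ t) + (B t).mulVec (Ψ t)) t ∧
        HasDerivAt Ψ ((C t).mulVec (Φ t) + (D t).mulVec (Ψ t)) t) →
      Tendsto (fun t => euclNorm (Φ t)) atTop (nhds 0) ∧
        Tendsto (fun t => euclNorm (Ψ t)) atTop (nhds 0) := by
  intro Φ Ψ hsol
  obtain ⟨φ, ψ, hφ₀, hψ₀, hφψ⟩ := exists_planar_linear_solution h𝔞 (continuousOn_qOpNorm hB)
    (continuousOn_qOpNorm hC) h𝔡 (euclNorm (Φ t₀) + 1) (euclNorm (Ψ t₀) + 1)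
  obtain ⟨hφlim, hψlim⟩ := hscalar φ ψ hφψ
  have hcomp := lt_of_cooperative_comparison h𝔞 h𝔡 (fun t _ => qOpNorm_nonneg (B t))
    (fun t _ => qOpNorm_nonneg (C t)) (fun t ht => (hφψ t ht).1) (fun t ht => (hφψ t ht).2)
    (fun t => euclNorm_nonneg (Φ t)) (fun t => euclNorm_nonneg (Ψ t))
    (fun t ht => hasDerivAt_euclNorm_sq (hsol t ht).1)
    (fun t ht => hasDerivAt_euclNorm_sq (hsol t ht).2)
    (fun t ht => by
      have h₁ := sum_inner_mulVec_le_of_matInt hA h𝔞 hbA ht (Φ t)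
      have h₂ := sum_inner_mulVec_le (B t) (Φ t) (Ψ t)
      simp only [Pi.add_apply, inner_add_right, Finset.sum_add_distrib, euclNorm_sq]
      linarith)
    (fun t ht => by
      have h₁ := sum_inner_mulVec_le_of_matInt hD h𝔡 hbD ht (Ψ t)
      have h₂ := sum_inner_mulVec_le (C t) (Ψ t) (Φ t)
      simp only [Pi.add_apply, inner_add_right, Finset.sum_add_distrib, euclNorm_sq]
      linarith)
    (by linarith) (by linarith)
  have hev : ∀ᶠ t in atTop, t ∈ Ici t₀ := Ici_mem_atTop t₀
  exact ⟨squeeze_zero' (.of_forall fun t => euclNorm_nonneg _)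
      (hev.mono fun t ht => (hcomp t ht).1.le) hφlim,
    squeeze_zero' (.of_forall fun t => euclNorm_nonneg _)
      (hev.mono fun t ht => (hcomp t ht).2.le) hψlim⟩
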